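/- arXiv:2503.20045 — 2 statements merged into one kernel-verified Lean document; each statement's English description precedes it below -/
import Mathlib

section
/- Let ε > 0 and let k ≥ 4 be an integer. Let C be an orientation of the k-cycle that contains the oriented path v_1 → v_2 ← v_3 → v_4 ← v_5 as a subdigraph if k ≥ 5, or, if k = 4, let C be the orientation of the 4-cycle on vertices v_1, v_2, v_3, v_4 with arcs v_1v_2, v_3v_2, v_3v_4, v_1v_4 (obtained by identifying the endpoints of v_1 → v_2 ← v_3 → v_4 ← v_5). Then every digraph D without loops or parallel arcs with |V(D)| ≥ 12/ε², χ(D) ≥ 4·c*_{k−1}/ε and minimum out-degree at least ε·|V(D)| contains a subdigraph isomorphic to C. -/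
/-- A digraph `D` (given by its arc relation `E`) contains the digraph given by the
arc relation `F` as a subdigraph: there is an injective map of the vertices preserving arcs. -/
def ContainsDigraph {V W : Type*} (E : V → V → Prop) (F : W → W → Prop) : Prop :=
  ∃ f : W → V, Function.Injective f ∧ ∀ u v : W, F u v → E (f u) (f v)

/-- The orientation of the `k`-cycle determined by `o : ZMod k → Bool`:
the edge `i` of the cycle joins `i` and `i + 1`, and is oriented `i → i + 1`
when `o i = true`, and `i + 1 → i` when `o i = false`. -/
def cycleOrient {k : ℕ} (o : ZMod k → Bool) : ZMod k → ZMod k → Prop :=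
  fun u v => (o u = true ∧ v = u + 1) ∨ (o v = false ∧ u = v + 1)

/-- The arc obtained by orienting the edge `i` of the `k`-cycle according to `o`.
Injectivity of `cycleArc o` says that distinct edges yield distinct arcs, i.e. the
orientation is a genuine digraph without parallel arcs (this is automatic for `k ≥ 3`). -/
def cycleArc {k : ℕ} (o : ZMod k → Bool) (i : ZMod k) : ZMod k × ZMod k :=
  if o i then (i, i + 1) else (i + 1, i)

open Classical in
/-- The number of blocks of the orientation of the `k`-cycle given by `o`:
a directed cycle has a single block, and otherwise the blocks (maximal directed
subpaths) correspond bijectively to the indices `i` at which the orientation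
changes between the consecutive edges `i` and `i + 1`. -/
noncomputable def blockCount {k : ℕ} (o : ZMod k → Bool) : ℕ :=
  if ∀ i, o i = o 0 then 1 else {i : ZMod k | o i ≠ o (i + 1)}.ncard

/-- The orientation of the `k`-cycle given by `o` has a block of length one, i.e.
some edge `i + 1` is a maximal directed subpath on its own. -/
def hasShortBlock {k : ℕ} (o : ZMod k → Bool) : Prop :=
  ∃ i : ZMod k, o i ≠ o (i + 1) ∧ o (i + 1) ≠ o (i + 2)

/-- `T` is an orientation of a tree: a loopless relation, with at most one arc between
any two vertices, whose underlying undirected graph is a tree. -/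
def IsTreeOrientation {W : Type*} (T : W → W → Prop) : Prop :=
  (∀ v, ¬ T v v) ∧ (∀ u v, T u v → ¬ T v u) ∧ (SimpleGraph.fromRel T).IsTree

/-- The chromatic number of (the underlying undirected graph of) the digraph given
by the arc relation `E`. -/
noncomputable def dchrom {V : Type*} (E : V → V → Prop) : ℕ :=
  (SimpleGraph.fromRel E).chromaticNumber.toNat

/-- Burr's constant `c*_j`: the least positive integer `c` such that every digraph
(without loops or parallel arcs) with chromatic number at least `c` contains every
orientation of a tree on `j` vertices as a subdigraph. -/
noncomputable def cstar (j : ℕ) : ℕ :=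
  sInf {c : ℕ | 0 < c ∧
    ∀ (n : ℕ) (E : Fin n → Fin n → Prop), (∀ v, ¬ E v v) →
      (c : ℕ∞) ≤ (SimpleGraph.fromRel E).chromaticNumber →
      ∀ T : Fin j → Fin j → Prop, IsTreeOrientation T → ContainsDigraph E T}

/-- The oriented path `v₁ → v₂ ← v₃ → v₄ ← v₅` on five vertices. -/
def pathFBFB : Fin 5 → Fin 5 → Prop := fun u v =>
  (u = 0 ∧ v = 1) ∨ (u = 2 ∧ v = 1) ∨ (u = 2 ∧ v = 3) ∨ (u = 4 ∧ v = 3)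


/-- Digraphs in which all out-degrees inside `B` are at most `d` are `(2d+1)`-colourable. -/
theorem low_outdeg_color {V : Type*} (E : V → V → Prop)
    (hl : ∀ v, ¬ E v v) (d : ℕ) :
    ∀ (m : ℕ) (B : Finset V), B.card = m →
      (∀ v ∈ B, ∀ S : Finset V, S ⊆ B → (∀ u ∈ S, E v u) → S.card ≤ d) →
      ∃ c : V → ℕ, (∀ v, c v < 2 * d + 1) ∧ ∀ u ∈ B, ∀ v ∈ B, E u v → c u ≠ c v := by
  classical
  intro m
  induction m with
  | zero =>
    intro B hB _
    have : B = ∅ := Finset.card_eq_zero.mp hB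
    subst this
    exact ⟨fun _ => 0, by simp, by simp⟩
  | succ m ih =>
    intro B hB hd
    have hex : ∃ v ∈ B, (B.filter (fun u => E u v)).card ≤ d := by
      by_contra hcon
      push Not at hcon
      have h1 : ∑ v ∈ B, (B.filter (fun u => E u v)).card
          = ∑ v ∈ B, (B.filter (fun u => E v u)).card := by
        simp only [Finset.card_filter]
        exact Finset.sum_comm
      have h2 : ∑ v ∈ B, (B.filter (fun u => E v u)).card ≤ ∑ v ∈ B, d :=
        Finset.sum_le_sum (fun v hv => hd v hv _ (Finset.filter_subset _ _)
          (fun u hu => (Finset.mem_filter.mp hu).2))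
      have h3 : ∑ v ∈ B, d < ∑ v ∈ B, (B.filter (fun u => E u v)).card :=
        Finset.sum_lt_sum_of_nonempty (Finset.card_pos.mp (by omega)) hcon
      omega
    obtain ⟨v, hv, hin⟩ := hex
    obtain ⟨c, hc, hcp⟩ := ih (B.erase v) (by rw [Finset.card_erase_of_mem hv]; omega)
      (fun w hw S hS hSE => hd w (Finset.mem_of_mem_erase hw) S
        (hS.trans (Finset.erase_subset _ _)) hSE)
    have hout : (B.filter (fun u => E v u)).card ≤ d :=
      hd v hv _ (Finset.filter_subset _ _) (fun u hu => (Finset.mem_filter.mp hu).2)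
    set F := ((B.filter (fun u => E u v)) ∪ (B.filter (fun u => E v u))).image c with hF
    have hFc : F.card ≤ 2 * d := by
      calc F.card ≤ _ := Finset.card_image_le
        _ ≤ _ := Finset.card_union_le _ _
        _ ≤ 2 * d := by omega
    obtain ⟨a, ha, haF⟩ : ∃ a ∈ Finset.range (2 * d + 1), a ∉ F := by
      apply Finset.exists_mem_notMem_of_card_lt_card
      simp; omega
    refine ⟨Function.update c v a, ?_, ?_⟩
    · intro w
      by_cases h : w = v
      · subst h; simpa using ha
      · simpa [Function.update_of_ne h] using hc w
    · intro x hx y hy hxy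
      by_cases h : x = v
      · subst h
        have hyx : y ≠ x := by rintro rfl; exact hl _ hxy
        rw [Function.update_self, Function.update_of_ne hyx]
        rintro rfl
        exact haF (Finset.mem_image_of_mem c (by simp [hy, hxy]))
      · by_cases h' : y = v
        · subst h'
          rw [Function.update_self, Function.update_of_ne h]
          rintro rfl
          exact haF (Finset.mem_image_of_mem c (by simp [hx, hxy]))
        · rw [Function.update_of_ne h, Function.update_of_ne h']
          exact hcp x (by simp [h, hx]) y (by simp [h', hy]) hxy

/-- One step of Burr's theorem: the leaf is extended along the relation `R`. -/
theorem split_color {V : Type*} [Fintype V] (E : V → V → Prop) (hl : ∀ v, ¬ E v v)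
    (d N : ℕ) (A : Finset V) (P : Finset V → Prop)
    (hP : ∀ B : Finset V, P B ∨
      ∃ c : V → ℕ, (∀ v, c v < N + 1) ∧ ∀ u ∈ B, ∀ v ∈ B, E u v → c u ≠ c v) :
    (∃ B ⊆ A, P B ∧ ∀ v ∈ B, ∃ S : Finset V, S ⊆ A ∧ (∀ u ∈ S, E v u) ∧ d < S.card) ∨
      ∃ c : V → ℕ, (∀ v, c v < (N + 2 * d + 1) + 1) ∧
        ∀ u ∈ A, ∀ v ∈ A, E u v → c u ≠ c v := by
  classical
  set B := A.filter (fun v => ∃ S : Finset V, S ⊆ A ∧ (∀ u ∈ S, E v u) ∧ d < S.card) with hB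
  rcases hP B with h | ⟨c, hc, hcp⟩
  · exact Or.inl ⟨B, Finset.filter_subset _ _, h, fun v hv => (Finset.mem_filter.mp hv).2⟩
  · right
    obtain ⟨c', hc', hcp'⟩ := low_outdeg_color E hl d _ (A \ B) rfl (by
      intro v hv S hS hSE
      by_contra hcon
      rw [Finset.mem_sdiff] at hv
      exact hv.2 (Finset.mem_filter.mpr
        ⟨hv.1, S, hS.trans Finset.sdiff_subset, hSE, by omega⟩))
    refine ⟨fun v => if v ∈ B then c v else N + 1 + c' v, ?_, ?_⟩
    · intro v
      have := hc v
      have := hc' v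
      dsimp only
      split_ifs <;> omega
    · intro u hu v hv huv
      have h1 := hc u
      have h2 := hc v
      dsimp only
      split_ifs with h3 h4 h4
      · exact hcp u h3 v h4 huv
      · omega
      · omega
      · have := hcp' u (by simp [hu, h3]) v (by simp [hv, h4]) huv
        omega

/-- Burr's theorem in a colouring form. -/
theorem burr_aux (j : ℕ) : ∃ N : ℕ, ∀ (W : Type) [Fintype W] (T : W → W → Prop),
    Fintype.card W = j + 1 → IsTreeOrientation T →
    ∀ (V : Type) [Fintype V] (E : V → V → Prop), (∀ v, ¬ E v v) → ∀ A : Finset V,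
      (∃ f : W → V, Function.Injective f ∧ (∀ w, f w ∈ A) ∧ ∀ u v, T u v → E (f u) (f v)) ∨
      ∃ c : V → ℕ, (∀ v, c v < N + 1) ∧ ∀ u ∈ A, ∀ v ∈ A, E u v → c u ≠ c v := by
  classical
  induction j with
  | zero =>
    refine ⟨0, ?_⟩
    intro W _ T hW hT V _ E hl A
    rcases A.eq_empty_or_nonempty with rfl | ⟨a, ha⟩
    · exact Or.inr ⟨fun _ => 0, by simp, by simp⟩
    · left
      have hs : Subsingleton W := Fintype.card_le_one_iff_subsingleton.mp (by omega)
      refine ⟨fun _ => a, fun x y _ => Subsingleton.elim x y, fun _ => ha, ?_⟩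
      intro u v huv
      rw [Subsingleton.elim u v] at huv
      exact absurd huv (hT.1 v)
  | succ j ih =>
    obtain ⟨N, hN⟩ := ih
    refine ⟨N + 2 * (j + 1) + 1, ?_⟩
    intro W _ T hW hT V _ E hl A
    obtain ⟨hT1, hT2, hT3⟩ := hT
    have hnt : Nontrivial W := Fintype.one_lt_card_iff_nontrivial.mp (by omega)
    obtain ⟨l, hdl⟩ := hT3.exists_vert_degree_one_of_nontrivial
    have hconn := hT3.connected.induce_compl_singleton_of_degree_eq_one hdl
    obtain ⟨p, hp, hpu⟩ := SimpleGraph.degree_eq_one_iff_existsUnique_adj.mp hdl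
    have hpl : p ≠ l := hp.ne'
    let W' := {w : W // w ≠ l}
    let T' : W' → W' → Prop := fun a b => T a b
    have hT' : IsTreeOrientation T' := by
      refine ⟨fun v => hT1 v, fun u v => hT2 u v, ?_⟩
      have he : SimpleGraph.fromRel T' = (SimpleGraph.fromRel T).induce {l}ᶜ := by
        ext a b
        change (a ≠ b ∧ (T a b ∨ T b a)) ↔ ((a : W) ≠ b ∧ (T a b ∨ T b a))
        rw [Ne, Ne, Subtype.ext_iff]
      have hc2 : (SimpleGraph.fromRel T').Connected := by rw [he]; exact hconn
      refine ⟨hc2, ?_⟩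
      have := hT3.isAcyclic.induce ({l}ᶜ)
      rw [he]; exact this
    have hW' : Fintype.card W' = j + 1 := by
      have : Fintype.card W' = Fintype.card W - 1 := by
        simp [W', Fintype.card_subtype_compl]
      omega
    -- extension of an embedding of the smaller tree
    have key : ∀ R : V → V → Prop,
        (∀ f : W → V, R (f p) (f l) → (∀ a b, a ≠ l → b ≠ l → T a b → E (f a) (f b)) →
          ∀ a b, T a b → E (f a) (f b)) →
        (∃ B ⊆ A, (∃ f : W' → V, Function.Injective f ∧ (∀ w, f w ∈ B) ∧
            ∀ u v, T' u v → E (f u) (f v)) ∧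
          ∀ v ∈ B, ∃ S : Finset V, S ⊆ A ∧ (∀ u ∈ S, R v u) ∧ j + 1 < S.card) →
        (∃ f : W → V, Function.Injective f ∧ (∀ w, f w ∈ A) ∧
          ∀ u v, T u v → E (f u) (f v)) := by
      intro R hR ⟨B, hBA, ⟨f, hf, hfB, hfT⟩, hS⟩
      obtain ⟨S, hSA, hSR, hSc⟩ := hS _ (hfB ⟨p, hpl⟩)
      obtain ⟨x, hxS, hx⟩ : ∃ x ∈ S, x ∉ Finset.univ.image f := by
        apply Finset.exists_mem_notMem_of_card_lt_card
        refine lt_of_le_of_lt Finset.card_image_le ?_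
        rw [Finset.card_univ, hW']; exact hSc
      have hx' : ∀ w, f w ≠ x := fun w hw => hx (by simp only [Finset.mem_image, Finset.mem_univ, true_and]; exact ⟨w, hw⟩)
      refine ⟨fun w => if h : w = l then x else f ⟨w, h⟩, ?_, ?_, ?_⟩
      · intro a b hab
        by_cases ha : a = l <;> by_cases hb : b = l
        · rw [ha, hb]
        · simp only [ha, hb, dif_pos, dif_neg, not_false_eq_true] at hab
          exact absurd hab.symm (hx' _)
        · simp only [ha, hb, dif_pos, dif_neg, not_false_eq_true] at hab
          exact absurd hab (hx' _)
        · simp only [ha, hb, dif_neg, not_false_eq_true] at hab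
          exact congrArg Subtype.val (hf hab)
      · intro w
        dsimp only
        split_ifs with h
        · exact hSA hxS
        · exact hBA (hfB _)
      · apply hR
        · simp only [dif_pos, hpl, dif_neg, not_false_eq_true]
          exact hSR x hxS
        · intro a b ha hb hab
          simp only [ha, hb, dif_neg, not_false_eq_true]
          exact hfT ⟨a, ha⟩ ⟨b, hb⟩ hab
    have hp' : T l p ∨ T p l := by
      have := hp
      rw [SimpleGraph.fromRel_adj] at this
      exact this.2
    have honly1 : ∀ a, T a l → a = p := by
      intro a ha
      apply hpu
      rw [SimpleGraph.fromRel_adj]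
      exact ⟨by rintro rfl; exact hT1 _ ha, Or.inr ha⟩
    have honly2 : ∀ a, T l a → a = p := by
      intro a ha
      apply hpu
      rw [SimpleGraph.fromRel_adj]
      exact ⟨by rintro rfl; exact hT1 _ ha, Or.inl ha⟩
    rcases hp' with hlp | hpl'
    · rcases split_color (fun a b => E b a) hl (j + 1) N A _ (fun B => by
        rcases hN W' T' hW' hT' V E hl B with h | ⟨c, h1, h2⟩
        · exact Or.inl h
        · exact Or.inr ⟨c, h1, fun u hu v hv huv => (h2 v hv u hu huv).symm⟩) with h | ⟨c, h1, h2⟩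
      · left
        refine key (fun a b => E b a) ?_ h
        intro f h1 h2 a b hab
        by_cases ha : a = l
        · subst ha; rw [honly2 b hab]; exact h1
        · by_cases hb : b = l
          · subst hb
            rw [honly1 a hab] at hab
            exact absurd hab (hT2 _ _ hlp)
          · exact h2 a b ha hb hab
      · exact Or.inr ⟨c, h1, fun u hu v hv huv => (h2 v hv u hu huv).symm⟩
    · rcases split_color E hl (j + 1) N A _ (fun B => hN W' T' hW' hT' V E hl B) with h | h
      · left
        refine key E ?_ h
        intro f h1 h2 a b hab
        by_cases ha : a = l
        · subst ha
          rw [honly2 b hab] at hab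
          exact absurd hab (hT2 _ _ hpl')
        · by_cases hb : b = l
          · subst hb; rw [honly1 a hab]; exact h1
          · exact h2 a b ha hb hab
      · exact Or.inr h

/-- Burr's theorem: `cstar j` satisfies its defining property for `j ≥ 1`. -/
theorem cstar_spec (j : ℕ) (hj : 1 ≤ j) : 0 < cstar j ∧
    ∀ (n : ℕ) (E : Fin n → Fin n → Prop), (∀ v, ¬ E v v) →
      (cstar j : ℕ∞) ≤ (SimpleGraph.fromRel E).chromaticNumber →
      ∀ T : Fin j → Fin j → Prop, IsTreeOrientation T → ContainsDigraph E T := by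
  refine Nat.sInf_mem (s := {c : ℕ | 0 < c ∧
    ∀ (n : ℕ) (E : Fin n → Fin n → Prop), (∀ v, ¬ E v v) →
      (c : ℕ∞) ≤ (SimpleGraph.fromRel E).chromaticNumber →
      ∀ T : Fin j → Fin j → Prop, IsTreeOrientation T → ContainsDigraph E T}) ?_
  obtain ⟨N, hN⟩ := burr_aux (j - 1)
  refine ⟨N + 2, by omega, ?_⟩
  intro n E hl hchi T hT
  rcases hN (Fin j) T (by simp; omega) hT (Fin n) E hl Finset.univ with ⟨f, hf, -, h⟩ | ⟨c, h1, h2⟩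
  · exact ⟨f, hf, h⟩
  · exfalso
    have hcol : (SimpleGraph.fromRel E).Colorable (N + 1) := by
      refine ⟨SimpleGraph.Coloring.mk (fun v => (⟨c v, h1 v⟩ : Fin (N + 1))) ?_⟩
      intro u v huv heq
      have heq' : c u = c v := congrArg Fin.val heq
      rw [SimpleGraph.fromRel_adj] at huv
      rcases huv.2 with h | h
      · exact h2 u (by simp) v (by simp) h heq'
      · exact h2 v (by simp) u (by simp) h heq'.symm
    have := hchi.trans hcol.chromaticNumber_le
    have h3 : N + 2 ≤ N + 1 := by exact_mod_cast this
    omega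

/-- The centre of the alternating path. -/
theorem cycle_center (k : ℕ) (hk : 4 ≤ k) (o : ZMod k → Bool)
    (hC : (k = 4 ∧ ∀ i : ZMod k, o i = decide (i.val % 2 = 0)) ∨
          (5 ≤ k ∧ ContainsDigraph (cycleOrient o) pathFBFB)) :
    ∃ s : ZMod k, o (s - 2) = true ∧ o (s - 1) = false ∧ o s = true ∧ o (s + 1) = false := by
  rcases hC with ⟨rfl, h⟩ | ⟨hk5, f, hf, hE⟩
  · refine ⟨0, ?_, ?_, ?_, ?_⟩ <;> rw [h] <;> decide
  · have h01 := hE 0 1 (by simp [pathFBFB])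
    have h21 := hE 2 1 (by simp [pathFBFB])
    have h23 := hE 2 3 (by simp [pathFBFB])
    have h43 := hE 4 3 (by simp [pathFBFB])
    have n02 : f 0 ≠ f 2 := fun h => absurd (hf h) (by decide)
    have n13 : f 1 ≠ f 3 := fun h => absurd (hf h) (by decide)
    have n24 : f 2 ≠ f 4 := fun h => absurd (hf h) (by decide)
    refine ⟨f 2, ?_⟩
    unfold cycleOrient at h01 h21 h23 h43
    rcases h21 with ⟨a1, b1⟩ | ⟨a1, b1⟩
    · rcases h23 with ⟨a2, b2⟩ | ⟨a2, b2⟩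
      · exact absurd (b1.trans b2.symm) n13
      · rcases h01 with ⟨a3, b3⟩ | ⟨a3, b3⟩
        · exact absurd (add_right_cancel (b3.symm.trans b1)) n02
        · rcases h43 with ⟨a4, b4⟩ | ⟨a4, b4⟩
          · have e3 : f 2 - 1 = f 3 := by rw [b2]; ring
            have e4 : f 2 - 2 = f 4 := by rw [b2, b4]; ring
            rw [e3, e4, ← b1]
            exact ⟨a4, a2, a1, a3⟩
          · exact absurd (b2.trans b4.symm) n24
    · rcases h23 with ⟨a2, b2⟩ | ⟨a2, b2⟩
      · rcases h01 with ⟨a3, b3⟩ | ⟨a3, b3⟩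
        · rcases h43 with ⟨a4, b4⟩ | ⟨a4, b4⟩
          · exact absurd (add_right_cancel (b2.symm.trans b4)) n24
          · have e3 : f 2 - 1 = f 1 := by rw [b1]; ring
            have e4 : f 2 - 2 = f 0 := by rw [b1, b3]; ring
            rw [e3, e4, ← b2]
            exact ⟨a3, a1, a2, a4⟩
        · exact absurd (b3.trans b1.symm) n02
      · exact absurd (add_right_cancel (b1.symm.trans b2)) n13

/-- Orientation of a path on `Fin m`. -/
def pathOr (m : ℕ) (p : ℕ → Bool) : Fin m → Fin m → Prop := fun a b =>
  (p a.val = true ∧ b.val = a.val + 1) ∨ (p b.val = false ∧ a.val = b.val + 1)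

theorem pathOr_tree (m : ℕ) (hm : 1 ≤ m) (p : ℕ → Bool) : IsTreeOrientation (pathOr m p) := by
  refine ⟨?_, ?_, ?_⟩
  · rintro v (⟨_, h⟩ | ⟨_, h⟩) <;> omega
  · rintro u v (⟨h1, h⟩ | ⟨h1, h⟩) (⟨h2, h'⟩ | ⟨h2, h'⟩)
    · omega
    · rw [h1] at h2; exact absurd h2 (by simp)
    · rw [h1] at h2; exact absurd h2 (by simp)
    · omega
  · obtain ⟨m, rfl⟩ : ∃ r, m = r + 1 := ⟨m - 1, by omega⟩
    have he : SimpleGraph.fromRel (pathOr (m + 1) p) = SimpleGraph.pathGraph (m + 1) := by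
      ext a b
      rw [SimpleGraph.fromRel_adj, SimpleGraph.pathGraph_adj]
      unfold pathOr
      have hab : a ≠ b ↔ a.val ≠ b.val := by rw [Ne, Fin.ext_iff]
      rw [hab]
      constructor
      · rintro ⟨_, (⟨_, h⟩ | ⟨_, h⟩) | (⟨_, h⟩ | ⟨_, h⟩)⟩ <;> omega
      · rintro (h | h)
        · refine ⟨by omega, ?_⟩
          cases hp : p a.val
          · exact Or.inr (Or.inr ⟨rfl, h.symm⟩)
          · exact Or.inl (Or.inl ⟨rfl, h.symm⟩)
        · refine ⟨by omega, ?_⟩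
          cases hp : p b.val
          · exact Or.inl (Or.inr ⟨rfl, h.symm⟩)
          · exact Or.inr (Or.inl ⟨rfl, h.symm⟩)
    rw [he, SimpleGraph.isTree_iff_connected_and_card]
    have hconn := SimpleGraph.pathGraph_connected m
    refine ⟨hconn, le_antisymm ?_ hconn.card_vert_le_card_edgeSet_add_one⟩
    have : Nat.card (SimpleGraph.pathGraph (m + 1)).edgeSet ≤ Nat.card (Fin m) := by
      refine Nat.card_le_card_of_surjective (α := Fin m)
        (fun i => ⟨s(i.castSucc, i.succ), by
          rw [SimpleGraph.mem_edgeSet, SimpleGraph.pathGraph_adj]; simp⟩) ?_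
      rintro ⟨e, hee⟩
      induction e with
      | _ a b =>
        rw [SimpleGraph.mem_edgeSet, SimpleGraph.pathGraph_adj] at hee
        rcases hee with h | h
        · refine ⟨⟨a.val, by omega⟩, ?_⟩
          apply Subtype.ext
          have h1 : (⟨a.val, by omega⟩ : Fin m).castSucc = a := Fin.ext (by simp)
          have h2 : (⟨a.val, by omega⟩ : Fin m).succ = b := Fin.ext (by simp [h])
          simp only [h1, h2]
        · refine ⟨⟨b.val, by omega⟩, ?_⟩
          apply Subtype.ext
          have h1 : (⟨b.val, by omega⟩ : Fin m).castSucc = b := Fin.ext (by simp)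
          have h2 : (⟨b.val, by omega⟩ : Fin m).succ = a := Fin.ext (by simp [h])
          simp only [h1, h2]
          exact Sym2.eq_swap
    simp at this ⊢
    omega

/-- In every vertex class either the oriented path embeds or the class has few colours. -/
theorem class_alt (m : ℕ) (hm : 2 ≤ m) (p : ℕ → Bool) (n : ℕ) (E : Fin n → Fin n → Prop)
    (hl : ∀ v, ¬ E v v) (B : Fin n → Prop) :
    (∃ g : ℕ → Fin n, Set.InjOn g {i | i < m} ∧ (∀ i < m, B (g i)) ∧
      ∀ i, i + 1 < m → (p i = true → E (g i) (g (i + 1))) ∧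
        (p i = false → E (g (i + 1)) (g i))) ∨
    (∃ c : Fin n → Fin (cstar m - 1), ∀ u v, B u → B v → E u v → c u ≠ c v) := by
  obtain ⟨hpos, hc⟩ := cstar_spec m (by omega)
  let E' : Fin n → Fin n → Prop := fun u v => E u v ∧ B u ∧ B v
  by_cases hchi : (cstar m : ℕ∞) ≤ (SimpleGraph.fromRel E').chromaticNumber
  · left
    obtain ⟨f, hf, hfE⟩ := hc n E' (fun v h => hl v h.1) hchi _ (pathOr_tree m (by omega) p)
    let g : ℕ → Fin n := fun i => if h : i < m then f ⟨i, h⟩ else f ⟨0, by omega⟩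
    have hg : ∀ i (h : i < m), g i = f ⟨i, h⟩ := fun i h => dif_pos h
    have harc : ∀ i, i + 1 < m → (p i = true → E' (g i) (g (i + 1))) ∧
        (p i = false → E' (g (i + 1)) (g i)) := by
      intro i hi
      rw [hg i (by omega), hg (i + 1) hi]
      exact ⟨fun h => hfE _ _ (Or.inl ⟨h, rfl⟩), fun h => hfE _ _ (Or.inr ⟨h, rfl⟩)⟩
    refine ⟨g, ?_, ?_, ?_⟩
    · intro i hi j hj hij
      rw [hg i hi, hg j hj] at hij
      exact congrArg Fin.val (hf hij)
    · intro i hi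
      by_cases h : i + 1 < m
      · cases hp : p i
        · exact ((harc i h).2 hp).2.2
        · exact ((harc i h).1 hp).2.1
      · obtain ⟨r, rfl⟩ : ∃ r, i = r + 1 := ⟨i - 1, by omega⟩
        cases hp : p r
        · exact ((harc r hi).2 hp).2.1
        · exact ((harc r hi).1 hp).2.2
    · intro i hi
      exact ⟨fun h => ((harc i hi).1 h).1, fun h => ((harc i hi).2 h).1⟩
  · right
    have hcol : (SimpleGraph.fromRel E').Colorable (cstar m - 1) := by
      rw [← SimpleGraph.chromaticNumber_le_iff_colorable]
      push Not at hchi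
      have h1 : (cstar m : ℕ∞) = ((cstar m - 1 : ℕ) : ℕ∞) + 1 := by
        have h2 : cstar m = (cstar m - 1) + 1 := by omega
        conv_lhs => rw [h2]
        exact Nat.cast_succ _
      rw [h1] at hchi
      exact Order.le_of_lt_add_one hchi
    obtain ⟨c⟩ := hcol
    refine ⟨c, fun u v hu hv huv => c.valid ?_⟩
    rw [SimpleGraph.fromRel_adj]
    exact ⟨by rintro rfl; exact hl _ huv, Or.inl ⟨huv, hu, hv⟩⟩

/-- Closing up the cycle through a vertex `x`. -/
theorem cycle_embed {V : Type*} (k : ℕ) (hk : 4 ≤ k) (o : ZMod k → Bool) (E : V → V → Prop)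
    (s : ZMod k) (h1 : o (s - 1) = false) (h0 : o s = true) (x : V) (g : ℕ → V)
    (hg : Set.InjOn g {i | i < k - 1}) (hx : ∀ i < k - 1, g i ≠ x)
    (harc : ∀ i : ℕ, i + 1 < k - 1 → (o (s + 1 + i) = true → E (g i) (g (i + 1))) ∧
        (o (s + 1 + i) = false → E (g (i + 1)) (g i)))
    (hx0 : E x (g 0)) (hx1 : E x (g (k - 2))) : ContainsDigraph E (cycleOrient o) := by
  have : NeZero k := ⟨by omega⟩
  have : Fact (1 < k) := ⟨by omega⟩
  let h : ℕ → V := fun i => if i = 0 then x else g (i - 1)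
  let f : ZMod k → V := fun z => h (z - s).val
  have hedge : ∀ u : ZMod k, (o u = true → E (f u) (f (u + 1))) ∧
      (o u = false → E (f (u + 1)) (f u)) := by
    intro u
    have hu : u = s + ((u - s).val : ZMod k) := by rw [ZMod.natCast_zmod_val]; ring
    have hlt := ZMod.val_lt (u - s)
    have hs : u + 1 - s = (u - s) + 1 := by ring
    simp only [f]
    rw [hs]
    by_cases hlast : (u - s).val = k - 1
    · have hz : (u - s) + 1 = 0 := by
        rw [← ZMod.natCast_zmod_val (u - s), hlast]
        have : ((k - 1 : ℕ) : ZMod k) + 1 = ((k - 1 + 1 : ℕ) : ZMod k) := by push_cast; rfl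
        rw [this, Nat.sub_add_cancel (by omega), ZMod.natCast_self]
      have hus : u = s - 1 := by linear_combination hz
      rw [hz, hlast, ZMod.val_zero]
      have hh : h (k - 1) = g (k - 2) := by
        simp only [h]; rw [if_neg (by omega)]; congr 1
      rw [hh, hus, h1]
      exact ⟨fun h => absurd h (by simp), fun _ => hx1⟩
    · have hv : ((u - s) + 1).val = (u - s).val + 1 := by
        rw [ZMod.val_add_of_lt, ZMod.val_one]
        rw [ZMod.val_one]; omega
      rw [hv]
      generalize (u - s).val = i at *
      rcases Nat.eq_zero_or_pos i with rfl | hi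
      · have hus : u = s := by simpa using hu
        rw [hus, h0]
        exact ⟨fun _ => hx0, fun h => absurd h (by simp)⟩
      · obtain ⟨r, rfl⟩ : ∃ r, i = r + 1 := ⟨i - 1, by omega⟩
        have hus : u = s + 1 + (r : ZMod k) := by rw [hu]; push_cast; ring
        rw [hus]
        exact harc r (by omega)
  refine ⟨f, ?_, ?_⟩
  · intro a b hab
    have ha := ZMod.val_lt (a - s)
    have hb := ZMod.val_lt (b - s)
    have hv : (a - s).val = (b - s).val := by
      simp only [f, h] at hab
      split_ifs at hab with c1 c2 c2
      · omega
      · exact absurd hab.symm (hx _ (by omega))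
      · exact absurd hab (hx _ (by omega))
      · have := hg (show (a - s).val - 1 < k - 1 by omega)
          (show (b - s).val - 1 < k - 1 by omega) hab
        omega
    have := ZMod.val_injective k hv
    exact sub_left_injective this
  · rintro u v (⟨hu, rfl⟩ | ⟨hv, rfl⟩)
    · exact (hedge u).1 hu
    · exact (hedge v).2 hv

/-- A family of sets with pairwise intersections of size at most one. -/
theorem packing_sum {α β : Type*} [DecidableEq α] [DecidableEq β] (N : α → Finset β)
    (S : Finset α) (hS : ∀ x ∈ S, ∀ y ∈ S, x ≠ y → (N x ∩ N y).card ≤ 1) :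
    ∑ x ∈ S, (N x).card ≤ (S.biUnion N).card + S.card ^ 2 := by
  induction S using Finset.induction_on with
  | empty => simp
  | insert a S ha ih =>
    have ih' := ih (fun x hx y hy => hS x (by simp [hx]) y (by simp [hy]))
    rw [Finset.sum_insert ha, Finset.biUnion_insert, Finset.card_insert_of_notMem ha]
    have h1 := Finset.card_union_add_card_inter (N a) (S.biUnion N)
    have h2 : (N a ∩ S.biUnion N).card ≤ S.card := by
      rw [Finset.inter_biUnion]
      refine Finset.card_biUnion_le.trans ?_
      calc ∑ x ∈ S, (N a ∩ N x).card ≤ ∑ x ∈ S, 1 :=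
            Finset.sum_le_sum (fun x hx => hS a (by simp) x (by simp [hx])
              (by rintro rfl; exact ha hx))
        _ = S.card := by simp
    nlinarith

theorem packing_card {n : ℕ} (ε : ℝ) (hε : 0 < ε) (N : Fin n → Finset (Fin n))
    (hn : 12 / ε ^ 2 ≤ (n : ℝ)) (hN : ∀ x, ε * n ≤ ((N x).card : ℝ))
    (S : Finset (Fin n)) (hS : ∀ x ∈ S, ∀ y ∈ S, x ≠ y → (N x ∩ N y).card ≤ 1) :
    (S.card : ℝ) ≤ 2 / ε := by
  by_contra hcon
  push Not at hcon
  have hnpos : (0 : ℝ) < n := lt_of_lt_of_le (by positivity) hn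
  have hn0 : 0 < n := by exact_mod_cast hnpos
  have hε1 : ε ≤ 1 := by
    have h1 := hN ⟨0, hn0⟩
    have h2 : ((N ⟨0, hn0⟩).card : ℝ) ≤ n := by
      have := Finset.card_le_univ (N ⟨0, hn0⟩)
      rw [Fintype.card_fin] at this
      exact_mod_cast this
    by_contra h3
    push Not at h3
    nlinarith
  set m := ⌊2 / ε⌋₊ + 1 with hm
  have hm1 : 2 / ε < m := by rw [hm]; exact_mod_cast Nat.lt_floor_add_one (2 / ε)
  have hm2 : (m : ℝ) ≤ 2 / ε + 1 := by
    rw [hm]; push_cast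
    have := Nat.floor_le (show 0 ≤ 2 / ε by positivity)
    linarith
  have hmS : m ≤ S.card := (Nat.floor_lt (by positivity)).mpr hcon
  obtain ⟨S', hS', hc⟩ := Finset.exists_subset_card_eq hmS
  have h1 := packing_sum N S' (fun x hx y hy => hS x (hS' hx) y (hS' hy))
  have h2 : (S'.biUnion N).card ≤ n := by
    have := Finset.card_le_univ (S'.biUnion N)
    rwa [Fintype.card_fin] at this
  have h3 : (m : ℝ) * (ε * n) ≤ ∑ x ∈ S', ((N x).card : ℝ) := by
    rw [← hc, ← nsmul_eq_mul, ← Finset.sum_const]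
    exact Finset.sum_le_sum (fun x _ => hN x)
  have h4 : ∑ x ∈ S', ((N x).card : ℝ) ≤ n + (m : ℝ) ^ 2 := by
    rw [hc] at h1
    have : ∑ x ∈ S', (N x).card ≤ n + m ^ 2 := by omega
    exact_mod_cast this
  have h5 : 2 < m * ε := by rwa [div_lt_iff₀ hε] at hm1
  have h6 : m * ε ≤ 3 := by
    have : (2 / ε + 1) * ε = 2 + ε := by field_simp
    nlinarith
  have h7 : 12 ≤ n * ε ^ 2 := by rwa [div_le_iff₀ (by positivity)] at hn
  have h8 : (n : ℝ) < (m : ℝ) ^ 2 := by nlinarith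
  have h9 : (n : ℝ) * ε ^ 2 < (m * ε) ^ 2 := by
    rw [mul_pow]; exact mul_lt_mul_of_pos_right h8 (by positivity)
  nlinarith

/-- Lemma 2.1. Let `C` be an orientation of the `k`-cycle (`k ≥ 4`) which, if `k ≥ 5`,
contains `→ ← → ←` as a subdigraph, and, if `k = 4`, is the orientation of the 4-cycle
obtained by identifying the endpoints of `→ ← → ←` (edges alternate: `o i = true` iff
`i` is even). Every digraph without loops or parallel arcs with `|V(D)| ≥ 12/ε²`,
`χ(D) ≥ 4·c*_{k-1}/ε`, and minimum out-degree at least `ε·|V(D)|` contains `C`. -/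
theorem contains_cycle_with_fbfb
    (ε : ℝ) (hε : 0 < ε) (k : ℕ) (hk : 4 ≤ k) (o : ZMod k → Bool)
    (hC : (k = 4 ∧ ∀ i : ZMod k, o i = decide (i.val % 2 = 0)) ∨
          (5 ≤ k ∧ ContainsDigraph (cycleOrient o) pathFBFB))
    (n : ℕ) (E : Fin n → Fin n → Prop) (hloops : ∀ v, ¬ E v v)
    (hn : 12 / ε ^ 2 ≤ (n : ℝ))
    (hchrom : 4 * (cstar (k - 1) : ℝ) / ε ≤ (dchrom E : ℝ))
    (hdeg : ∀ v : Fin n, ε * (n : ℝ) ≤ (Nat.card {u : Fin n // E v u} : ℝ)) :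
    ContainsDigraph E (cycleOrient o) := by
  classical
  by_contra hno
  obtain ⟨s, hs2, hs1, hs0, hsp⟩ := cycle_center k hk o hC
  let N : Fin n → Finset (Fin n) := fun x => Finset.univ.filter (fun u => E x u)
  have hNmem : ∀ x u, u ∈ N x ↔ E x u := fun x u => by simp [N]
  have hN : ∀ x, ε * n ≤ ((N x).card : ℝ) := by
    intro x
    have := hdeg x
    rwa [Nat.card_eq_fintype_card, Fintype.card_subtype] at this
  -- a maximal packing
  obtain ⟨S, hSmem, hSmax⟩ := Finset.exists_max_image
    ((Finset.univ : Finset (Finset (Fin n))).filter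
      (fun S => ∀ x ∈ S, ∀ y ∈ S, x ≠ y → (N x ∩ N y).card ≤ 1)) Finset.card
    ⟨∅, by simp⟩
  have hS := (Finset.mem_filter.mp hSmem).2
  have hSc := packing_card ε hε N hn hN S hS
  have hrep : ∀ v : Fin n, ∃ x : S, (v ∈ S → x.1 = v) ∧ (v ∉ S → 2 ≤ (N v ∩ N x.1).card) := by
    intro v
    by_cases hv : v ∈ S
    · exact ⟨⟨v, hv⟩, fun _ => rfl, fun h => absurd hv h⟩
    · by_contra hcon
      have hlow : ∀ x ∈ S, (N v ∩ N x).card ≤ 1 := by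
        intro x hx
        by_contra h
        exact hcon ⟨⟨x, hx⟩, fun h' => absurd h' hv, fun _ => by simp only; omega⟩
      have := hSmax (insert v S) (by
        rw [Finset.mem_filter]
        refine ⟨Finset.mem_univ _, ?_⟩
        intro x hx y hy hxy
        rcases Finset.mem_insert.mp hx with rfl | hx'
        · rcases Finset.mem_insert.mp hy with rfl | hy'
          · exact absurd rfl hxy
          · exact hlow y hy'
        · rcases Finset.mem_insert.mp hy with rfl | hy'
          · rw [Finset.inter_comm]; exact hlow x hx'
          · exact hS x hx' y hy' hxy)
      rw [Finset.card_insert_of_notMem hv] at this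
      omega
  choose r hr1 hr2 using hrep
  have hsk1 : s + 1 + ((k - 3 : ℕ) : ZMod k) = s - 2 := by
    rw [Nat.cast_sub (by omega), ZMod.natCast_self]; push_cast; ring
  -- colouring of the out-neighbourhoods
  have hB : ∀ x : S, ∃ c : Fin n → Fin (cstar (k - 1) - 1),
      ∀ u v, E x.1 u → E x.1 v → E u v → c u ≠ c v := by
    intro x
    rcases class_alt (k - 1) (by omega) (fun i => o (s + 1 + i)) n E hloops (fun v => E x.1 v)
      with ⟨g, hg1, hg2, hg3⟩ | h
    · exact absurd (cycle_embed k hk o E s hs1 hs0 x.1 g hg1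
        (fun i hi h => hloops x.1 (by have := hg2 i hi; rwa [h] at this)) hg3
        (hg2 0 (by omega)) (hg2 (k - 2) (by omega))) hno
    · exact h
  -- colouring of the rest of the classes
  have hD : ∀ x : S, ∃ c : Fin n → Fin (cstar (k - 1) - 1),
      ∀ u v, (u ≠ x.1 ∧ ¬ E x.1 u ∧ 2 ≤ (N u ∩ N x.1).card) →
        (v ≠ x.1 ∧ ¬ E x.1 v ∧ 2 ≤ (N v ∩ N x.1).card) → E u v → c u ≠ c v := by
    intro x
    rcases class_alt (k - 1) (by omega) (fun i => o (s + 1 + i)) n E hloops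
      (fun u => u ≠ x.1 ∧ ¬ E x.1 u ∧ 2 ≤ (N u ∩ N x.1).card)
      with ⟨g, hg1, hg2, hg3⟩ | h
    · exfalso
      obtain ⟨a, ha⟩ : (N (g 1) ∩ N x.1).Nonempty :=
        Finset.card_pos.mp (by have := (hg2 1 (by omega)).2.2; omega)
      obtain ⟨b, hb, hba⟩ := Finset.exists_mem_ne
        (show 1 < (N (g (k - 3)) ∩ N x.1).card from (hg2 (k - 3) (by omega)).2.2) a
      rw [Finset.mem_inter, hNmem, hNmem] at ha hb
      have hga : ∀ i < k - 1, g i ≠ a := fun i hi h => (hg2 i hi).2.1 (h ▸ ha.2)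
      have hgb : ∀ i < k - 1, g i ≠ b := fun i hi h => (hg2 i hi).2.1 (h ▸ hb.2)
      have hk2 : k - 2 ≠ 0 := by omega
      let g' : ℕ → Fin n := fun i => if i = 0 then a else if i = k - 2 then b else g i
      have e0 : g' 0 = a := if_pos rfl
      have e2 : g' (k - 2) = b := by simp only [g']; rw [if_neg hk2]; exact if_pos trivial
      have e1 : ∀ i, i ≠ 0 → i ≠ k - 2 → g' i = g i := fun i h1 h2 => by
        simp only [g']; rw [if_neg h1, if_neg h2]
      refine hno (cycle_embed k hk o E s hs1 hs0 x.1 g' ?_ ?_ ?_ ?_ ?_)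
      · intro i hi j hj hij
        simp only [Set.mem_ofPred_eq] at hi hj
        simp only [g'] at hij
        split_ifs at hij with c1 c2 c3 c4 c5 c6 c7
        · omega
        · exact absurd hij.symm hba
        · exact absurd hij.symm (hga j hj)
        · exact absurd hij hba
        · omega
        · exact absurd hij.symm (hgb j hj)
        · exact absurd hij (hga i hi)
        · exact absurd hij (hgb i hi)
        · exact hg1 hi hj hij
      · intro i hi h
        by_cases c1 : i = 0
        · rw [c1, e0] at h; exact hloops x.1 (by have := ha.2; rwa [h] at this)
        · by_cases c2 : i = k - 2
          · rw [c2, e2] at h; exact hloops x.1 (by have := hb.2; rwa [h] at this)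
          · rw [e1 i c1 c2] at h; exact (hg2 i hi).1 h
      · intro i hi
        by_cases c1 : i = 0
        · subst c1
          rw [e0, e1 (0 + 1) (by omega) (by omega)]
          have : o (s + 1 + ((0 : ℕ) : ZMod k)) = false := by simpa using hsp
          rw [this]
          exact ⟨fun h => absurd h (by simp), fun _ => ha.1⟩
        · by_cases c2 : i = k - 3
          · subst c2
            have e3 : k - 3 + 1 = k - 2 := by omega
            rw [hsk1, hs2, e3, e2, e1 (k - 3) c1 (by omega)]
            exact ⟨fun _ => hb.1, fun h => absurd h (by simp)⟩
          · rw [e1 i c1 (by omega), e1 (i + 1) (by omega) (by omega)]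
            exact hg3 i hi
      · rw [e0]; exact ha.2
      · rw [e2]; exact hb.2
    · exact h
  choose cB hcB using hB
  choose cD hcD using hD
  let col : Fin n → S × Option (Bool × Fin (cstar (k - 1) - 1)) := fun v =>
    (r v, if v ∈ S then none else
      if E (r v).1 v then some (true, cB (r v) v) else some (false, cD (r v) v))
  have hcolE : ∀ u v, E u v → col u ≠ col v := by
    intro u v huv heq
    simp only [col, Prod.mk.injEq] at heq
    obtain ⟨h1, h2⟩ := heq
    have huv' : u ≠ v := by rintro rfl; exact hloops _ huv
    by_cases hu : u ∈ S
    · by_cases hv : v ∈ S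
      · exact huv' (by rw [← hr1 u hu, ← hr1 v hv, h1])
      · rw [if_pos hu, if_neg hv] at h2
        split_ifs at h2
    · by_cases hv : v ∈ S
      · rw [if_neg hu, if_pos hv] at h2
        split_ifs at h2
      · rw [if_neg hu, if_neg hv, h1] at h2
        have hu2 := hr2 u hu
        have hv2 := hr2 v hv
        rw [h1] at hu2
        have hux : u ≠ (r v).1 := by rintro h; exact hu (h ▸ (r v).2)
        have hvx : v ≠ (r v).1 := by intro h; exact hv (by rw [h]; exact (r v).2)
        by_cases c1 : E (r v).1 u <;> by_cases c2 : E (r v).1 v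
        · rw [if_pos c1, if_pos c2] at h2
          simp only [Option.some.injEq, Prod.mk.injEq, true_and] at h2
          exact hcB _ u v c1 c2 huv h2
        · rw [if_pos c1, if_neg c2] at h2
          simp at h2
        · rw [if_neg c1, if_pos c2] at h2
          simp at h2
        · rw [if_neg c1, if_neg c2] at h2
          simp only [Option.some.injEq, Prod.mk.injEq, true_and] at h2
          exact hcD _ u v ⟨hux, c1, hu2⟩ ⟨hvx, c2, hv2⟩ huv h2
  have hcolorable := (SimpleGraph.Coloring.mk (G := SimpleGraph.fromRel E) col (by
    intro u v huv
    rw [SimpleGraph.fromRel_adj] at huv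
    rcases huv.2 with h | h
    · exact hcolE u v h
    · exact (hcolE v u h).symm)).colorable
  have hle : dchrom E ≤ S.card * (2 * (cstar (k - 1) - 1) + 1) := by
    have h1 := hcolorable.chromaticNumber_le
    have h2 := ENat.toNat_le_of_le_natCast h1
    simpa [dchrom, Fintype.card_prod, Fintype.card_option] using h2
  have hcpos := (cstar_spec (k - 1) (by omega)).1
  obtain ⟨c, hc⟩ : ∃ c, cstar (k - 1) = c + 1 := ⟨cstar (k - 1) - 1, by omega⟩
  rw [hc] at hle hchrom
  have hle' : (dchrom E : ℝ) ≤ S.card * (2 * c + 1) := by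
    have : dchrom E ≤ S.card * (2 * c + 1) := by simpa using hle
    exact_mod_cast this
  have h3 : (S.card : ℝ) * (2 * c + 1) ≤ 2 / ε * (2 * c + 1) :=
    mul_le_mul_of_nonneg_right hSc (by positivity)
  have h4 : 4 * ((c + 1 : ℕ) : ℝ) / ε = 2 / ε * (2 * c + 1) + 2 / ε := by
    push_cast; field_simp; ring
  have h5 : 0 < 2 / ε := by positivity
  linarith
end

section
/- Let 0 < ε < 1/2 and let k ≥ 4 be an integer. Let D be a digraph without loops or parallel arcs with |V(D)| ≥ 48k/ε³, χ(D) ≥ 16·c*_{k−1}/(ε^{⌈2/ε⌉}·(1−2ε)) and minimum out-degree at least ε·|V(D)|, and let C be an orientation of the k-cycle consisting of more than two blocks. Then D contains a subdigraph isomorphic to C. -/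
/-- `S` can be properly coloured with `m` colours. -/
def Colr {V : Type*} (E : V → V → Prop) (S : Set V) (m : ℕ) : Prop :=
  ∃ c : V → ℕ, (∀ v ∈ S, c v < m) ∧ ∀ u ∈ S, ∀ v ∈ S, E u v → c u ≠ c v

theorem Colr.mono {V : Type*} {E : V → V → Prop} {S S' : Set V} {m m' : ℕ}
    (h : Colr E S m) (hS : S' ⊆ S) (hm : m ≤ m') : Colr E S' m' := by
  obtain ⟨c, h1, h2⟩ := h
  exact ⟨c, fun v hv => (h1 v (hS hv)).trans_le hm, fun u hu v hv => h2 u (hS hu) v (hS hv)⟩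

theorem Colr.union {V : Type*} {E : V → V → Prop} {A B : Set V} {a b : ℕ}
    (hA : Colr E A a) (hB : Colr E B b) : Colr E (A ∪ B) (a + b) := by
  classical
  obtain ⟨c, h1, h2⟩ := hA
  obtain ⟨d, h3, h4⟩ := hB
  refine ⟨fun v => if v ∈ A then c v else a + d v, ?_, ?_⟩
  · intro v hv
    by_cases hvA : v ∈ A
    · have := h1 v hvA
      simp only [hvA, if_true]; omega
    · have := h3 v (hv.resolve_left hvA)
      simp only [hvA, if_false]; omega
  · intro u hu v hv huv
    by_cases huA : u ∈ A <;> by_cases hvA : v ∈ A <;> simp only [huA, hvA, if_true, if_false]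
    · exact h2 u huA v hvA huv
    · have := h1 u huA; omega
    · have := h1 v hvA; omega
    · have := h4 u (hu.resolve_left huA) v (hv.resolve_left hvA) huv
      omega

theorem Colr.of_finset {V : Type*} {E : V → V → Prop} (hE : ∀ v, ¬ E v v) (S : Finset V) :
    Colr E (S : Set V) S.card := by
  classical
  refine ⟨fun v => if h : v ∈ S then (S.equivFin ⟨v, h⟩ : ℕ) else 0, ?_, ?_⟩
  · intro v hv
    have hv' : v ∈ S := hv
    simp only [hv', dif_pos]
    exact Fin.isLt _
  · intro u hu v hv huv
    have hu' : u ∈ S := hu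
    have hv' : v ∈ S := hv
    simp only [hu', hv', dif_pos]
    intro h
    have := S.equivFin.injective (Fin.ext h)
    have : u = v := by simpa using this
    subst this
    exact hE _ huv

theorem colr_of_colorable {V : Type*} {E : V → V → Prop} {S : Set V} {N : ℕ}
    (hE : ∀ v, ¬ E v v) (e : Fin N → V) (he : Set.SurjOn e Set.univ S)
    {m : ℕ} (h : (SimpleGraph.fromRel (fun i j => E (e i) (e j))).Colorable m) : Colr E S m := by
  classical
  obtain ⟨c⟩ := h
  have hs : ∀ v ∈ S, ∃ i, e i = v := fun v hv => by
    obtain ⟨i, -, hi⟩ := he hv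
    exact ⟨i, hi⟩
  refine ⟨fun v => if h : ∃ i, e i = v then (c h.choose : ℕ) else 0, ?_, ?_⟩
  · intro v hv
    simp only [hs v hv, dif_pos]
    exact Fin.isLt _
  · intro u hu v hv huv
    simp only [hs v hv, hs u hu, dif_pos]
    intro h
    have h1 := (hs u hu).choose_spec
    have h2 := (hs v hv).choose_spec
    have h3 := Fin.ext h
    refine c.valid ?_ h3
    rw [SimpleGraph.fromRel_adj]
    refine ⟨fun h4 => ?_, Or.inl ?_⟩
    · rw [h4, h2] at h1
      subst h1
      exact hE _ huv
    · rw [h1, h2]; exact huv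

theorem colorable_of_colr {V : Type*} {E : V → V → Prop} {m : ℕ}
    (h : Colr E Set.univ m) : (SimpleGraph.fromRel E).Colorable m := by
  obtain ⟨c, h1, h2⟩ := h
  refine ⟨SimpleGraph.Coloring.mk (fun v => ⟨c v, h1 v trivial⟩) ?_⟩
  intro u v huv h
  have h' : c u = c v := congrArg Fin.val h
  rw [SimpleGraph.fromRel_adj] at huv
  rcases huv.2 with h3 | h3
  · exact h2 _ trivial _ trivial h3 h'
  · exact h2 _ trivial _ trivial h3 h'.symm

/-- degenerate colouring -/
theorem colr_degenerate {V : Type*} (E : V → V → Prop) (hE : ∀ v, ¬ E v v) (d : ℕ) :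
    ∀ (N : ℕ) (Y : Finset V), Y.card = N →
      (∀ v ∈ Y, {u | u ∈ Y ∧ E v u}.ncard ≤ d) → Colr E (Y : Set V) (2 * d + 1) := by
  classical
  intro N
  induction N with
  | zero =>
    intro Y hY _
    rw [Finset.card_eq_zero] at hY
    subst hY
    exact ⟨fun _ => 0, by simp, by simp⟩
  | succ N ih =>
    intro Y hY hd
    have hd' : ∀ v ∈ Y, (Y.filter (fun u => E v u)).card ≤ d := by
      intro v hv
      have := hd v hv
      rwa [show {u | u ∈ Y ∧ E v u} = ((Y.filter (fun u => E v u) : Finset V) : Set V) by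
        ext; simp, Set.ncard_coe_finset] at this
    have hex : ∃ v ∈ Y, (Y.filter (fun u => E u v)).card ≤ d := by
      by_contra hcon
      push Not at hcon
      have h1 : ∑ v ∈ Y, (Y.filter (fun u => E v u)).card
          = ∑ v ∈ Y, (Y.filter (fun u => E u v)).card :=
        Finset.sum_card_bipartiteAbove_eq_sum_card_bipartiteBelow E
      have h2 : ∑ v ∈ Y, (Y.filter (fun u => E v u)).card
          < ∑ v ∈ Y, (Y.filter (fun u => E u v)).card := by
        apply Finset.sum_lt_sum_of_nonempty
        · rw [← Finset.card_pos]; omega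
        · intro v hv
          exact (hd' v hv).trans_lt (hcon v hv)
      omega
    obtain ⟨v, hv, hvd⟩ := hex
    obtain ⟨c, hc1, hc2⟩ := ih (Y.erase v) (by rw [Finset.card_erase_of_mem hv]; omega) (by
      intro u hu
      refine le_trans (Set.ncard_le_ncard ?_ ?_) (hd u (Finset.mem_of_mem_erase hu))
      · rintro w ⟨hw, hw2⟩
        exact ⟨Finset.mem_of_mem_erase hw, hw2⟩
      · exact Y.finite_toSet.subset (fun w hw => hw.1))
    let B : Finset ℕ := ((Y.filter (fun u => E v u)) ∪ (Y.filter (fun u => E u v))).image c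
    have hB : B.card < (Finset.range (2 * d + 1)).card := by
      rw [Finset.card_range]
      have h1 : B.card ≤ _ := Finset.card_image_le
      have h2 := Finset.card_union_le (Y.filter (fun u => E v u)) (Y.filter (fun u => E u v))
      have h3 := hd' v hv
      omega
    obtain ⟨x, hx1, hx2⟩ := Finset.exists_mem_notMem_of_card_lt_card hB
    have hxB : ∀ u ∈ Y, E v u ∨ E u v → c u ≠ x := by
      intro u hu h h'
      apply hx2
      refine Finset.mem_image.2 ⟨u, ?_, h'⟩
      simp only [Finset.mem_union, Finset.mem_filter]
      tauto
    refine ⟨Function.update c v x, ?_, ?_⟩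
    · intro u hu
      by_cases huv : u = v
      · subst huv; simpa using hx1
      · rw [Function.update_of_ne huv]
        exact hc1 u (by simpa [huv] using hu)
    · intro u hu w hw huw
      by_cases huv : u = v
      · subst huv
        have hwu : w ≠ u := fun h => hE _ (h ▸ huw)
        rw [Function.update_self, Function.update_of_ne hwu]
        exact (hxB w hw (Or.inl huw)).symm
      · rw [Function.update_of_ne huv]
        by_cases hwv : w = v
        · subst hwv
          rw [Function.update_self]
          exact hxB u hu (Or.inr huw)
        · rw [Function.update_of_ne hwv]
          exact hc2 u (by simpa [huv] using hu) w (by simpa [hwv] using hw) huw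

theorem colr_lowdeg {V : Type*} [Finite V] (E : V → V → Prop) (hE : ∀ v, ¬ E v v) (d : ℕ)
    (S : Set V) : Colr E {v | v ∈ S ∧ {u | u ∈ S ∧ E v u}.ncard ≤ d} (2 * d + 1) := by
  classical
  have hfin : {v | v ∈ S ∧ {u | u ∈ S ∧ E v u}.ncard ≤ d}.Finite := Set.toFinite _
  have := colr_degenerate E hE d _ hfin.toFinset rfl (by
    intro v hv
    simp only [Set.Finite.mem_toFinset, Set.mem_ofPred_eq] at hv
    refine le_trans (Set.ncard_le_ncard ?_ (Set.toFinite _)) hv.2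
    rintro u ⟨hu, hvu⟩
    simp only [Set.Finite.mem_toFinset, Set.mem_ofPred_eq] at hu
    exact ⟨hu.1, hvu⟩)
  simpa using this

theorem Colr.flip {V : Type*} {E : V → V → Prop} {S : Set V} {m : ℕ}
    (h : Colr (fun u v => E v u) S m) : Colr E S m := by
  obtain ⟨c, h1, h2⟩ := h
  exact ⟨c, h1, fun u hu v hv huv => (h2 v hv u hu huv).symm⟩

/-- Burr's theorem (weak bound). -/
theorem burr (j : ℕ) : ∃ c : ℕ, ∀ (V : Type) [Finite V] (E : V → V → Prop), (∀ v, ¬ E v v) →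
    ∀ S : Set V, ¬ Colr E S c → ∀ (W : Type) [Finite W] (T : W → W → Prop), Nat.card W = j + 1 →
      IsTreeOrientation T →
      ∃ f : W → V, Function.Injective f ∧ (∀ w, f w ∈ S) ∧ ∀ u v, T u v → E (f u) (f v) := by
  classical
  induction j with
  | zero =>
    refine ⟨0, ?_⟩
    intro V _ E hE S hS W _ T hW hT
    have hne : S.Nonempty := by
      by_contra h
      rw [Set.not_nonempty_iff_eq_empty] at h
      subst h
      exact hS ⟨fun _ => 0, by simp, by simp⟩
    obtain ⟨s, hs⟩ := hne
    have := (Nat.card_eq_one_iff_unique.1 hW).1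
    refine ⟨fun _ => s, fun a b _ => Subsingleton.elim a b, fun _ => hs, fun u v huv => ?_⟩
    rw [Subsingleton.elim u v] at huv
    exact absurd huv (hT.1 v)
  | succ j ih =>
    obtain ⟨c, hc⟩ := ih
    refine ⟨c + (2 * (j + 1) + 1) + (2 * (j + 1) + 1), ?_⟩
    intro V _ E hE S hS W _ T hW hT
    have : Fintype W := Fintype.ofFinite W
    have : Nontrivial W := by
      rw [← Fintype.one_lt_card_iff_nontrivial, ← Nat.card_eq_fintype_card]; omega
    obtain ⟨w, hw⟩ := hT.2.2.exists_vert_degree_one_of_nontrivial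
    have hconn := hT.2.2.connected.induce_compl_singleton_of_degree_eq_one hw
    obtain ⟨p, hp, hpu⟩ := SimpleGraph.degree_eq_one_iff_existsUnique_adj.1 hw
    have hpw : p ≠ w := hp.ne'
    set X1 := {v | v ∈ S ∧ {u | u ∈ S ∧ E v u}.ncard ≤ j + 1} with hX1
    set X2 := {v | v ∈ S ∧ {u | u ∈ S ∧ E u v}.ncard ≤ j + 1} with hX2
    have c1 : Colr E X1 _ := colr_lowdeg E hE (j + 1) S
    have c2 : Colr E X2 _ := (colr_lowdeg (fun u v => E v u) hE (j + 1) S).flip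
    have hS' : ¬ Colr E (S \ (X1 ∪ X2)) c := by
      intro h
      apply hS
      refine ((h.union c1).union c2).mono ?_ le_rfl
      intro v hv
      by_cases h1 : v ∈ X1
      · exact Or.inl (Or.inr h1)
      · by_cases h2 : v ∈ X2
        · exact Or.inr h2
        · exact Or.inl (Or.inl ⟨hv, by simp [h1, h2]⟩)
    obtain ⟨f, hf1, hf2, hf3⟩ := hc V E hE _ hS' ({w}ᶜ : Set W) (fun a b => T a b) (by
        rw [Nat.card_coe_set_eq, Set.ncard_compl, Set.ncard_singleton, hW]; rfl) (by
        refine ⟨fun v => hT.1 v, fun u v => hT.2.1 u v, ?_⟩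
        have heq : SimpleGraph.fromRel (fun a b : ({w}ᶜ : Set W) => T a b)
            = (SimpleGraph.fromRel T).induce ({w}ᶜ : Set W) := by
          ext a b
          simp [SimpleGraph.fromRel_adj, Subtype.ext_iff]
        rw [heq]
        exact ⟨hconn, hT.2.2.isAcyclic.induce _⟩)
    have hcardim : (Set.range f).ncard = j + 1 := by
      rw [← Set.image_univ, Set.ncard_image_of_injective _ hf1, Set.ncard_univ,
        Nat.card_coe_set_eq, Set.ncard_compl, Set.ncard_singleton, hW]; rfl
    obtain ⟨⟨hpS, hpX⟩⟩ : _ ∧ True := ⟨hf2 ⟨p, hpw⟩, trivial⟩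
    have hout : j + 1 < {u | u ∈ S ∧ E (f ⟨p, hpw⟩) u}.ncard := by
      by_contra h
      exact hpX (Or.inl ⟨hpS, not_lt.1 h⟩)
    have hin : j + 1 < {u | u ∈ S ∧ E u (f ⟨p, hpw⟩)}.ncard := by
      by_contra h
      exact hpX (Or.inr ⟨hpS, not_lt.1 h⟩)
    have hz : ∃ z, z ∈ S ∧ z ∉ Set.range f ∧ (T p w → E (f ⟨p, hpw⟩) z) ∧
        (T w p → E z (f ⟨p, hpw⟩)) := by
      by_cases hTp : T p w
      · rw [← hcardim] at hout
        obtain ⟨z, hz1, hz2⟩ := Set.exists_mem_notMem_of_ncard_lt_ncard hout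
        exact ⟨z, hz1.1, hz2, fun _ => hz1.2, fun h => absurd h (hT.2.1 _ _ hTp)⟩
      · rw [← hcardim] at hin
        obtain ⟨z, hz1, hz2⟩ := Set.exists_mem_notMem_of_ncard_lt_ncard hin
        exact ⟨z, hz1.1, hz2, fun h => absurd h hTp, fun _ => hz1.2⟩
    obtain ⟨z, hzS, hzr, hz1, hz2⟩ := hz
    have hzr' : ∀ a, f a ≠ z := fun a h => hzr ⟨a, h⟩
    refine ⟨fun a => if h : a = w then z else f ⟨a, h⟩, ?_, ?_, ?_⟩
    · intro a b hab
      by_cases ha : a = w <;> by_cases hb : b = w <;> simp only [ha, hb, dif_pos, dif_neg, not_false_eq_true] at hab ⊢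
      · exact absurd hab.symm (hzr' _)
      · exact absurd hab (hzr' _)
      · exact congrArg Subtype.val (hf1 hab)
    · intro a
      by_cases ha : a = w <;> simp only [ha, dif_pos, dif_neg, not_false_eq_true]
      · exact hzS
      · exact (hf2 _).1
    · intro a b hab
      have hadj : ∀ x, T x w ∨ T w x → x = p := by
        intro x hx
        apply hpu
        simp only [SimpleGraph.fromRel_adj]
        refine ⟨?_, by tauto⟩
        rintro rfl
        rcases hx with h | h <;> exact hT.1 _ h
      by_cases ha : a = w
      · have hb : b ≠ w := by rintro rfl; subst ha; exact hT.1 _ hab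
        subst ha
        have := hadj b (Or.inr hab)
        subst this
        simpa [hb] using hz2 hab
      · by_cases hb : b = w
        · subst hb
          have := hadj a (Or.inl hab)
          subst this
          simpa [ha] using hz1 hab
        · simpa [ha, hb] using hf3 ⟨a, ha⟩ ⟨b, hb⟩ hab

/-- path orientation -/
def pathRel (N : ℕ) (s : ℕ → Bool) : Fin N → Fin N → Prop :=
  fun u v => (s u = true ∧ (v : ℕ) = u + 1) ∨ (s v = false ∧ (u : ℕ) = v + 1)

theorem pathRel_tree (M : ℕ) (s : ℕ → Bool) : IsTreeOrientation (pathRel (M + 1) s) := by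
  refine ⟨?_, ?_, ?_⟩
  · rintro v (h | h) <;> omega
  · rintro u v (h | h) (h' | h')
    · omega
    · rw [h.1] at h'; simp at h'
    · rw [h.1] at h'; simp at h'
    · omega
  · have heq : SimpleGraph.fromRel (pathRel (M + 1) s) = SimpleGraph.pathGraph (M + 1) := by
      ext u v
      rw [SimpleGraph.fromRel_adj, SimpleGraph.pathGraph_adj]
      simp only [pathRel, ne_eq, Fin.ext_iff]
      cases s u <;> cases s v <;> simp <;> omega
    rw [heq, SimpleGraph.isTree_iff_connected_and_card]
    have hc := SimpleGraph.pathGraph_connected M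
    refine ⟨hc, le_antisymm ?_ hc.card_vert_le_card_edgeSet_add_one⟩
    rw [Nat.card_eq_fintype_card (α := Fin (M + 1)), Fintype.card_fin, Nat.card_coe_set_eq]
    have hsub : (SimpleGraph.pathGraph (M + 1)).edgeSet ⊆
        (fun i : Fin M => s(i.castSucc, i.succ)) '' Set.univ := by
      intro e
      induction e with
      | h a b =>
        rw [SimpleGraph.mem_edgeSet, SimpleGraph.pathGraph_adj]
        rintro (h | h)
        · refine ⟨⟨a, by omega⟩, trivial, ?_⟩
          simp [Fin.ext_iff]; omega
        · refine ⟨⟨b, by omega⟩, trivial, ?_⟩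
          simp [Fin.ext_iff]; omega
    have h1 := Set.ncard_le_ncard hsub (Set.toFinite _)
    have h2 := Set.ncard_image_le (f := fun i : Fin M => s(i.castSucc, i.succ))
      (Set.finite_univ)
    rw [Set.ncard_univ, Nat.card_eq_fintype_card, Fintype.card_fin] at h2
    omega

theorem cstar_mem (j : ℕ) : cstar (j + 1) ∈ {c : ℕ | 0 < c ∧
    ∀ (n : ℕ) (E : Fin n → Fin n → Prop), (∀ v, ¬ E v v) →
      (c : ℕ∞) ≤ (SimpleGraph.fromRel E).chromaticNumber →
      ∀ T : Fin (j + 1) → Fin (j + 1) → Prop, IsTreeOrientation T → ContainsDigraph E T} := by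
  apply Nat.sInf_mem
  obtain ⟨c, hc⟩ := burr j
  refine ⟨c + 1, Nat.succ_pos _, ?_⟩
  intro n E hE hχ T hT
  obtain ⟨f, h1, -, h3⟩ := hc (Fin n) E hE Set.univ (by
    intro h
    have := (colorable_of_colr h).chromaticNumber_le
    have := hχ.trans this
    rw [Nat.cast_le] at this
    omega) (Fin (j + 1)) T (by simp) hT
  exact ⟨f, h1, h3⟩

theorem le_cstar (j : ℕ) : j + 1 ≤ cstar (j + 1) := by
  by_contra hlt
  obtain ⟨-, h⟩ := cstar_mem j
  obtain ⟨f, hf, -⟩ := h j (fun u v => u ≠ v) (by simp) (by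
    have : SimpleGraph.fromRel (fun u v : Fin j => u ≠ v) = ⊤ := by
      ext u v
      simp only [SimpleGraph.fromRel_adj, SimpleGraph.top_adj]
      tauto
    rw [this, SimpleGraph.chromaticNumber_top]
    simp only [Fintype.card_fin, Nat.cast_le]
    omega) _ (pathRel_tree j (fun _ => true))
  have := Fintype.card_le_of_injective f hf
  simp at this

theorem exists_path {V : Type*} [Finite V] (E : V → V → Prop) (hE : ∀ v, ¬ E v v) (j : ℕ)
    (S : Set V) (hS : ¬ Colr E S (cstar (j + 1))) (s : ℕ → Bool) :
    ∃ p : ℕ → V, (∀ i ≤ j, ∀ i' ≤ j, p i = p i' → i = i') ∧ (∀ i ≤ j, p i ∈ S) ∧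
      ∀ i < j, (s i = true → E (p i) (p (i + 1))) ∧ (s i = false → E (p (i + 1)) (p i)) := by
  classical
  let e := (Finite.equivFin S).symm
  obtain ⟨-, h⟩ := cstar_mem j
  obtain ⟨f, hf, hf2⟩ := h (Nat.card S) (fun a b => E (e a) (e b)) (fun _ => hE _) (by
    by_contra hlt
    apply hS
    refine colr_of_colorable (N := Nat.card S) hE (fun i => (e i : V)) ?_
      (SimpleGraph.chromaticNumber_le_iff_colorable.1 (not_le.1 hlt).le)
    intro v hv
    exact ⟨e.symm ⟨v, hv⟩, trivial, congrArg Subtype.val (e.apply_symm_apply _)⟩) _ (pathRel_tree j s)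
  refine ⟨fun i => e (f (Fin.ofNat (j + 1) i)), ?_, ?_, ?_⟩
  · intro i hi i' hi' h
    have := hf (e.injective (Subtype.ext h))
    simp only [Fin.ofNat, Fin.mk.injEq] at this
    rwa [Nat.mod_eq_of_lt (by omega), Nat.mod_eq_of_lt (by omega)] at this
  · intro i hi
    exact Subtype.coe_prop _
  · intro i hi
    have h1 : i % (j + 1) = i := Nat.mod_eq_of_lt (by omega)
    have h2 : (i + 1) % (j + 1) = i + 1 := Nat.mod_eq_of_lt (by omega)
    constructor
    · intro hs
      exact hf2 _ _ (Or.inl ⟨by simpa [Fin.ofNat, h1] using hs, by simp [Fin.ofNat, h1, h2]⟩)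
    · intro hs
      exact hf2 _ _ (Or.inr ⟨by simpa [Fin.ofNat, h1] using hs, by simp [Fin.ofNat, h1, h2]⟩)

theorem exists_sinks {k : ℕ} (hk : 4 ≤ k) (o : ZMod k → Bool) (hb : 2 < blockCount o) :
    ∃ (t : ZMod k) (m : ℕ), 2 ≤ m ∧ m + 2 ≤ k ∧ o t = false ∧ o (t + ((k - 1 : ℕ) : ZMod k)) = true ∧
      o (t + (m : ZMod k)) = false ∧ o (t + ((m - 1 : ℕ) : ZMod k)) = true := by
  classical
  have : NeZero k := ⟨by omega⟩
  have hb' : 2 < {i : ZMod k | o i ≠ o (i + 1)}.ncard := by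
    unfold blockCount at hb
    split_ifs at hb
    · omega
    · exact hb
  set P : Finset (ZMod k) := Finset.univ.filter (fun i => o i = true ∧ o (i + 1) = false) with hP
  set Q : Finset (ZMod k) := Finset.univ.filter (fun i => o i = false ∧ o (i + 1) = true) with hQ
  have hPQ : P.card = Q.card := by
    have h1 : ∑ i : ZMod k, (if o (i + 1) = true then (1 : ℤ) else 0)
        = ∑ i : ZMod k, (if o i = true then (1 : ℤ) else 0) :=
      Equiv.sum_comp (Equiv.addRight (1 : ZMod k)) (fun i => if o i = true then (1 : ℤ) else 0)
    have h2 : (P.card : ℤ) - Q.card = ∑ i : ZMod k, ((if o i = true then (1 : ℤ) else 0)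
        - (if o (i + 1) = true then (1 : ℤ) else 0)) := by
      rw [hP, hQ, Finset.natCast_card_filter, Finset.natCast_card_filter, ← Finset.sum_sub_distrib]
      apply Finset.sum_congr rfl
      intro i _
      cases o i <;> cases o (i + 1) <;> simp
    rw [Finset.sum_sub_distrib, h1, sub_self] at h2
    omega
  have hU : {i : ZMod k | o i ≠ o (i + 1)} = ((P ∪ Q : Finset (ZMod k)) : Set (ZMod k)) := by
    ext i
    simp only [hP, hQ, Finset.coe_union, Finset.coe_filter, Set.mem_union, Finset.mem_univ,
      true_and, Set.mem_ofPred_eq]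
    cases o i <;> cases o (i + 1) <;> simp
  rw [hU, Set.ncard_coe_finset] at hb'
  have h3 := Finset.card_union_le P Q
  have hP2 : 1 < P.card := by omega
  obtain ⟨a, ha, b, hb2, hab⟩ := Finset.one_lt_card.1 hP2
  simp only [hP, Finset.mem_filter, Finset.mem_univ, true_and] at ha hb2
  have hm : (((b - a).val : ℕ) : ZMod k) = b - a := ZMod.natCast_zmod_val _
  have hlt : (b - a).val < k := ZMod.val_lt _
  have hk1 : ((k - 1 : ℕ) : ZMod k) = -1 := by
    rw [Nat.cast_sub (by omega)]; simp
  have h0 : (b - a).val ≠ 0 := by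
    intro h
    rw [h] at hm
    apply hab
    simp only [Nat.cast_zero] at hm
    exact (sub_eq_zero.1 hm.symm).symm
  have h1 : (b - a).val ≠ 1 := by
    intro h
    rw [h] at hm
    have : b = a + 1 := by
      simp only [Nat.cast_one] at hm
      rw [hm]; ring
    rw [this] at hb2
    rw [ha.2] at hb2
    simp at hb2
  have h2 : (b - a).val ≠ k - 1 := by
    intro h
    rw [h, hk1] at hm
    have : a = b + 1 := by
      have : b = a + -1 := by rw [hm]; ring
      rw [this]; ring
    rw [this] at ha
    rw [hb2.2] at ha
    simp at ha
  refine ⟨a + 1, (b - a).val, by omega, by omega, ha.2, ?_, ?_, ?_⟩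
  · rw [hk1]; simpa using ha.1
  · rw [hm, show a + 1 + (b - a) = b + 1 by ring]; exact hb2.2
  · rw [Nat.cast_sub (by omega), hm, show a + 1 + (b - a - ((1 : ℕ) : ZMod k)) = b by push_cast; ring]
    exact hb2.1

theorem contains_of_seq {V : Type*} {k : ℕ} (hk : 4 ≤ k) (E : V → V → Prop) (o : ZMod k → Bool)
    (t : ZMod k) (g : ℕ → V) (hinj : ∀ i < k, ∀ j < k, g i = g j → i = j)
    (harc : ∀ i < k, ∀ j, j = (if i + 1 = k then 0 else i + 1) →
      (o (t + (i : ZMod k)) = true → E (g i) (g j)) ∧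
      (o (t + (i : ZMod k)) = false → E (g j) (g i))) :
    ContainsDigraph E (cycleOrient o) := by
  have : NeZero k := ⟨by omega⟩
  have : Fact (1 < k) := ⟨by omega⟩
  have key : ∀ u : ZMod k, (o u = true → E (g (u - t).val) (g (u + 1 - t).val)) ∧
      (o u = false → E (g (u + 1 - t).val) (g (u - t).val)) := by
    intro u
    have h := harc (u - t).val (ZMod.val_lt _) (u + 1 - t).val (by
      have h1 : u + 1 - t = (u - t) + 1 := by ring
      have h2 := ZMod.val_lt (u - t)
      rw [h1, ZMod.val_add, ZMod.val_one]
      split_ifs with h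
      · rw [h, Nat.mod_self]
      · exact Nat.mod_eq_of_lt (by omega))
    rw [ZMod.natCast_zmod_val, add_sub_cancel] at h
    exact h
  refine ⟨fun z => g (z - t).val, ?_, ?_⟩
  · intro a b hab
    have := hinj _ (ZMod.val_lt _) _ (ZMod.val_lt _) hab
    exact sub_left_injective (ZMod.val_injective k this)
  · rintro u v (⟨h1, rfl⟩ | ⟨h1, rfl⟩)
    · exact (key u).1 h1
    · exact (key v).2 h1

theorem contains_of_paths {V : Type*} [Finite V] {k : ℕ} (hk : 4 ≤ k) (E : V → V → Prop)
    (o : ZMod k → Bool)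
    (t : ZMod k) (m : ℕ) (hm : 2 ≤ m) (hmk : m + 2 ≤ k) (h0 : o t = false)
    (hl : o (t + ((k - 1 : ℕ) : ZMod k)) = true)
    (hm0 : o (t + (m : ZMod k)) = false) (hm1 : o (t + ((m - 1 : ℕ) : ZMod k)) = true)
    (p q : ℕ → V)
    (hp : ∀ i ≤ k - 2, ∀ i' ≤ k - 2, p i = p i' → i = i')
    (hq : ∀ i ≤ k - 2, ∀ i' ≤ k - 2, q i = q i' → i = i')
    (hpq : ∀ i ≤ k - 2, ∀ i' ≤ k - 2, p i ≠ q i')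
    (ap : ∀ i < k - 2, (o (t + ((i + 1 : ℕ) : ZMod k)) = true → E (p i) (p (i + 1))) ∧
      (o (t + ((i + 1 : ℕ) : ZMod k)) = false → E (p (i + 1)) (p i)))
    (aq : ∀ i < k - 2, (o (t + ((i + m + 1 : ℕ) : ZMod k)) = true → E (q i) (q (i + 1))) ∧
      (o (t + ((i + m + 1 : ℕ) : ZMod k)) = false → E (q (i + 1)) (q i)))
    (c1 : 2 * k + 1 < ({u | E (p 0) u} ∩ {u | E (q (k - 2 - m)) u}).ncard)
    (c2 : 2 * k + 1 < ({u | E (p (m - 2)) u} ∩ {u | E (q 0) u}).ncard) :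
    ContainsDigraph E (cycleOrient o) := by
  classical
  let F : Finset V := (Finset.range k).image p ∪ (Finset.range k).image q
  have hF : F.card ≤ 2 * k := by
    have h1 := Finset.card_union_le ((Finset.range k).image p) ((Finset.range k).image q)
    have h2 := Finset.card_image_le (s := Finset.range k) (f := p)
    have h3 := Finset.card_image_le (s := Finset.range k) (f := q)
    simp only [Finset.card_range] at h2 h3
    change (_ ∪ _ : Finset V).card ≤ _
    omega
  have hFp : ∀ i < k, p i ∈ F := fun i hi =>
    Finset.mem_union_left _ (Finset.mem_image_of_mem _ (Finset.mem_range.2 hi))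
  have hFq : ∀ i < k, q i ∈ F := fun i hi =>
    Finset.mem_union_right _ (Finset.mem_image_of_mem _ (Finset.mem_range.2 hi))
  obtain ⟨a, ⟨ha1, ha2⟩, haF⟩ := Set.exists_mem_notMem_of_ncard_lt_ncard
    (s := (F : Set V)) (lt_of_le_of_lt (by rw [Set.ncard_coe_finset]; omega) c1)
  obtain ⟨b, ⟨hb1, hb2⟩, hbF⟩ := Set.exists_mem_notMem_of_ncard_lt_ncard
    (s := ((insert a F : Finset V) : Set V)) (lt_of_le_of_lt (by
      rw [Set.ncard_coe_finset]
      have := Finset.card_insert_le a F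
      omega) c2)
  have haF' : a ∉ F := haF
  have hbF' : b ∉ insert a F := hbF
  rw [Finset.mem_insert, not_or] at hbF'
  obtain ⟨hba, hbF'⟩ := hbF'
  have hap : ∀ i < k, p i ≠ a := fun i hi h => haF' (h ▸ hFp i hi)
  have haq : ∀ i < k, q i ≠ a := fun i hi h => haF' (h ▸ hFq i hi)
  have hbp : ∀ i < k, p i ≠ b := fun i hi h => hbF' (h ▸ hFp i hi)
  have hbq : ∀ i < k, q i ≠ b := fun i hi h => hbF' (h ▸ hFq i hi)
  let g : ℕ → V := fun i => if i = 0 then a else if i < m then p (i - 1) else if i = m then b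
    else q (i - m - 1)
  have g0 : g 0 = a := by simp [g]
  have g1 : ∀ i, 0 < i → i < m → g i = p (i - 1) := by
    intro i h1 h2
    simp only [g]
    rw [if_neg (by omega), if_pos h2]
  have g2 : g m = b := by
    simp only [g]
    rw [if_neg (by omega), if_neg (by omega)]; simp
  have g3 : ∀ i, m < i → g i = q (i - m - 1) := by
    intro i h1
    simp only [g]
    rw [if_neg (by omega), if_neg (by omega), if_neg (by omega)]
  have cases4 : ∀ i : ℕ, i = 0 ∨ (0 < i ∧ i < m) ∨ i = m ∨ m < i := by intro i; omega
  refine contains_of_seq hk E o t g ?_ ?_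
  · intro i hi j hj hij
    rcases cases4 i with rfl | ⟨hi1, hi2⟩ | rfl | hi1 <;>
    rcases cases4 j with rfl | ⟨hj1, hj2⟩ | rfl | hj1
    · rfl
    · rw [g0, g1 j hj1 hj2] at hij
      exact absurd hij.symm (hap _ (by omega))
    · rw [g0, g2] at hij
      exact absurd hij.symm hba
    · rw [g0, g3 j hj1] at hij
      exact absurd hij.symm (haq _ (by omega))
    · rw [g0, g1 i hi1 hi2] at hij
      exact absurd hij (hap _ (by omega))
    · rw [g1 i hi1 hi2, g1 j hj1 hj2] at hij
      have := hp _ (by omega) _ (by omega) hij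
      omega
    · rw [g1 i hi1 hi2, g2] at hij
      exact absurd hij (hbp _ (by omega))
    · rw [g1 i hi1 hi2, g3 j hj1] at hij
      exact absurd hij (hpq _ (by omega) _ (by omega))
    · rw [g2, g0] at hij
      exact absurd hij hba
    · rw [g2, g1 j hj1 hj2] at hij
      exact absurd hij.symm (hbp _ (by omega))
    · rfl
    · rw [g2, g3 j hj1] at hij
      exact absurd hij.symm (hbq _ (by omega))
    · rw [g0, g3 i hi1] at hij
      exact absurd hij (haq _ (by omega))
    · rw [g3 i hi1, g1 j hj1 hj2] at hij
      exact absurd hij.symm (hpq _ (by omega) _ (by omega))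
    · rw [g2, g3 i hi1] at hij
      exact absurd hij (hbq _ (by omega))
    · rw [g3 i hi1, g3 j hj1] at hij
      have := hq _ (by omega) _ (by omega) hij
      omega
  · intro i hi j hj
    rcases cases4 i with rfl | ⟨hi1, hi2⟩ | rfl | hi1
    · rw [if_neg (by omega)] at hj
      subst hj
      rw [g0, g1 1 (by omega) (by omega)]
      simp only [Nat.cast_zero, add_zero, h0]
      exact ⟨fun h => by simp at h, fun _ => ha1⟩
    · rw [if_neg (by omega)] at hj
      subst hj
      rw [g1 i hi1 hi2]
      by_cases him : i + 1 = m
      · rw [him, g2]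
        rw [show i = m - 1 by omega, hm1]
        refine ⟨fun _ => ?_, fun h => by simp at h⟩
        rw [show m - 1 - 1 = m - 2 by omega]
        exact hb1
      · rw [g1 (i + 1) (by omega) (by omega)]
        have := ap (i - 1) (by omega)
        rw [show i - 1 + 1 = i by omega] at this
        exact this
    · rw [if_neg (by omega)] at hj
      subst hj
      rw [g2, g3 _ (by omega), hm0, show i + 1 - i - 1 = 0 by omega]
      exact ⟨fun h => by simp at h, fun _ => hb2⟩
    · rw [g3 i hi1]
      split_ifs at hj with hik
      · subst hj
        rw [g0, show i = k - 1 by omega, hl, show k - 1 - m - 1 = k - 2 - m by omega]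
        exact ⟨fun _ => ha2, fun h => by simp at h⟩
      · subst hj
        rw [g3 _ (by omega)]
        have := aq (i - m - 1) (by omega)
        rw [show i - m - 1 + m + 1 = i by omega, show i - m - 1 + 1 = i + 1 - m - 1 by omega] at this
        exact this

/-- number of colours needed with `r` rounds left -/
def roundBound (c : ℕ) : ℕ → ℕ
  | 0 => 0
  | r + 1 => roundBound c r + roundBound c r + 2 * c

theorem roundBound_le (c r : ℕ) : roundBound c r + 2 * c ≤ 2 * c * 2 ^ r := by
  induction r with
  | zero => simp [roundBound]
  | succ r ih => rw [roundBound, pow_succ, ← mul_assoc]; omega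

theorem rounds {n : ℕ} (ε δ : ℝ) (hε0 : 0 < ε) (hδ0 : 0 ≤ δ) (T : ℕ)
    (hδ : (T : ℝ) * δ ≤ ε / 2) (hT : 1 ≤ (T : ℝ) * (ε / 2)) (hn0 : (0 : ℝ) < n)
    {k : ℕ} (hk : 4 ≤ k)
    (hδk : (2 * k + 1 : ℕ) < δ * n)
    (E : Fin n → Fin n → Prop) (hloops : ∀ v, ¬ E v v)
    (hdeg : ∀ v : Fin n, ε * (n : ℝ) ≤ ({u : Fin n | E v u}.ncard : ℝ))
    (o : ZMod k → Bool)
    (t : ZMod k) (m : ℕ) (hm : 2 ≤ m) (hmk : m + 2 ≤ k) (h0 : o t = false)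
    (hl : o (t + ((k - 1 : ℕ) : ZMod k)) = true)
    (hm0 : o (t + (m : ZMod k)) = false) (hm1 : o (t + ((m - 1 : ℕ) : ZMod k)) = true) :
    ∀ (r i : ℕ), i + r = T → ∀ W X : Set (Fin n), ¬ Colr E W (roundBound (cstar (k - 1)) r) →
      (∀ v ∈ W, ((({u | E v u} \ X).ncard : ℕ) : ℝ) ≤ i * δ * n) →
      (X.ncard : ℝ) ≤ n - i * (ε / 2) * n → ContainsDigraph E (cycleOrient o) := by
  classical
  intro r
  induction r with
  | zero =>
    intro i hi W X hW h1 h2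
    exfalso
    have hne : W.Nonempty := by
      by_contra h
      rw [Set.not_nonempty_iff_eq_empty] at h
      subst h
      exact hW ⟨fun _ => 0, by simp, by simp⟩
    obtain ⟨v, hv⟩ := hne
    have h3 := h1 v hv
    have h4 := hdeg v
    have h5 : {u | E v u}.ncard ≤ ({u | E v u} \ X).ncard + X.ncard :=
      Set.ncard_le_ncard_diff_add_ncard _ _ (Set.toFinite _)
    have h5' : ({u | E v u}.ncard : ℝ) ≤ ({u | E v u} \ X).ncard + X.ncard := by exact_mod_cast h5
    have : i = T := by omega
    subst this
    have h6 : (i : ℝ) * δ * n ≤ ε / 2 * n := by gcongr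
    have h7 : 1 * (n : ℝ) ≤ i * (ε / 2) * n := by gcongr
    have h8 : 0 < ε * n := by positivity
    linarith
  | succ r ih =>
    intro i hi W X hW h1 h2
    obtain ⟨j, rfl⟩ : ∃ j, k = j + 2 := ⟨k - 2, by omega⟩
    simp only [show j + 2 - 1 = j + 1 by omega, show j + 2 - 2 = j by omega] at *
    set c := cstar (j + 1) with hc
    have hjc : j + 1 ≤ c := le_cstar j
    obtain ⟨p, hp1, hp2, hp3⟩ := exists_path E hloops j W (fun h => hW (h.mono le_rfl (by
      rw [roundBound]; omega))) (fun i => o (t + ((i + 1 : ℕ) : ZMod (j + 2))))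
    -- the shrinking step
    have step : ∀ x ∈ W, ¬ Colr E {v | v ∈ W ∧ (({u | E x u} ∩ {u | E v u}).ncard : ℝ) < δ * n}
        (roundBound c r) → ContainsDigraph E (cycleOrient o) := by
      intro x hx hcol
      refine ih (i + 1) (by omega) _ (X \ {u | E x u}) hcol ?_ ?_
      · rintro v ⟨hv, hv2⟩
        have h3 := h1 v hv
        have h4 : ({u | E v u} \ (X \ {u | E x u})).ncard ≤
            ({u | E v u} \ X).ncard + ({u | E x u} ∩ {u | E v u}).ncard := by
          refine le_trans (Set.ncard_le_ncard ?_ (Set.toFinite _)) (Set.ncard_union_le _ _)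
          rintro u ⟨hu1, hu2⟩
          by_cases huX : u ∈ X
          · right
            refine ⟨?_, hu1⟩
            by_contra h
            exact hu2 ⟨huX, h⟩
          · left; exact ⟨hu1, huX⟩
        have h4' : (({u | E v u} \ (X \ {u | E x u})).ncard : ℝ) ≤
            ({u | E v u} \ X).ncard + ({u | E x u} ∩ {u | E v u}).ncard := by exact_mod_cast h4
        push_cast
        linarith
      · have h3 := h1 x hx
        have h4 := hdeg x
        have h5 : {u | E x u}.ncard ≤ ({u | E x u} \ X).ncard + ({u | E x u} ∩ X).ncard := by
          rw [add_comm, Set.ncard_inter_add_ncard_diff_eq_ncard _ _ (Set.toFinite _)]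
        have h6 : (X ∩ {u | E x u}).ncard + (X \ {u | E x u}).ncard = X.ncard :=
          Set.ncard_inter_add_ncard_diff_eq_ncard _ _ (Set.toFinite _)
        rw [Set.inter_comm] at h6
        have h5' : ({u | E x u}.ncard : ℝ) ≤ ({u | E x u} \ X).ncard + ({u | E x u} ∩ X).ncard := by
          exact_mod_cast h5
        have h6' : (({u | E x u} ∩ X).ncard : ℝ) + (X \ {u | E x u}).ncard = X.ncard := by
          exact_mod_cast h6
        have h7 : (i : ℝ) * δ * n ≤ ε / 2 * n := by
          have : (i : ℝ) ≤ T := by exact_mod_cast (by omega : i ≤ T)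
          have : (i : ℝ) * δ ≤ T * δ := by gcongr
          have : (i : ℝ) * δ ≤ ε / 2 := by linarith
          gcongr
        push_cast
        linarith
    by_contra hcon
    have cA := not_not.1 (fun h => hcon (step (p 0) (hp2 0 (by omega)) h))
    have cB := not_not.1 (fun h => hcon (step (p (m - 2)) (hp2 (m - 2) (by omega)) h))
    set A := {v | v ∈ W ∧ (({u | E (p 0) u} ∩ {u | E v u}).ncard : ℝ) < δ * n} with hA
    set B := {v | v ∈ W ∧ (({u | E (p (m - 2)) u} ∩ {u | E v u}).ncard : ℝ) < δ * n} with hB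
    set P : Finset (Fin n) := (Finset.range (j + 1)).image p with hP
    have cP : Colr E (P : Set (Fin n)) c := (Colr.of_finset hloops P).mono le_rfl (by
      have := Finset.card_image_le (s := Finset.range (j + 1)) (f := p)
      rw [Finset.card_range] at this
      exact this.trans hjc)
    have hR : ¬ Colr E (W \ (A ∪ B ∪ P)) c := by
      intro h
      apply hW
      refine ((cA.union cB).union (cP.union h)).mono ?_ (by rw [roundBound]; omega)
      intro v hv
      by_cases h1 : v ∈ A ∪ B
      · exact Or.inl h1
      · by_cases h2 : v ∈ (P : Set (Fin n))
        · exact Or.inr (Or.inl h2)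
        · exact Or.inr (Or.inr ⟨hv, fun h => h.elim h1 h2⟩)
    obtain ⟨q, hq1, hq2, hq3⟩ := exists_path E hloops j _ hR
      (fun i => o (t + ((i + m + 1 : ℕ) : ZMod (j + 2))))
    apply hcon
    refine contains_of_paths hk E o t m hm hmk h0 hl hm0 hm1 p q hp1 hq1 ?_ hp3 hq3 ?_ ?_
    · intro a ha b hb hab
      apply (hq2 b hb).2
      right
      rw [← hab]
      exact Finset.mem_coe.2 (Finset.mem_image_of_mem _ (Finset.mem_range.2 (by omega)))
    · have h := hq2 (j + 2 - 2 - m) (by omega)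
      by_contra hlt
      apply h.2
      left; left
      refine ⟨h.1, lt_of_le_of_lt ?_ hδk⟩
      exact_mod_cast not_lt.1 hlt
    · have h := hq2 0 (by omega)
      by_contra hlt
      apply h.2
      left; right
      refine ⟨h.1, lt_of_le_of_lt ?_ hδk⟩
      exact_mod_cast not_lt.1 hlt

/-- Lemma 2.4. Let `0 < ε < 1/2` and `k ≥ 4`. Every digraph without loops or parallel
arcs with `|V(D)| ≥ 48k/ε³`, `χ(D) ≥ 16·c*_{k-1}/(ε^⌈2/ε⌉·(1 - 2ε))`, and minimum
out-degree at least `ε·|V(D)|` contains every orientation of the `k`-cycle consisting of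
more than two blocks as a subdigraph. -/
theorem contains_cycle_with_more_than_two_blocks
    (ε : ℝ) (hε0 : 0 < ε) (hε : ε < 1 / 2) (k : ℕ) (hk : 4 ≤ k)
    (o : ZMod k → Bool) (hblocks : 2 < blockCount o)
    (n : ℕ) (E : Fin n → Fin n → Prop) (hloops : ∀ v, ¬ E v v)
    (hn : 48 * (k : ℝ) / ε ^ 3 ≤ (n : ℝ))
    (hchrom : 16 * (cstar (k - 1) : ℝ) / (ε ^ (⌈(2 : ℝ) / ε⌉₊) * (1 - 2 * ε)) ≤ (dchrom E : ℝ))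
    (hdeg : ∀ v : Fin n, ε * (n : ℝ) ≤ (Nat.card {u : Fin n // E v u} : ℝ)) :
    ContainsDigraph E (cycleOrient o) := by
  obtain ⟨t, m, hm, hmk, h0, hl, hm0, hm1⟩ := exists_sinks hk o hblocks
  set T := ⌈(2 : ℝ) / ε⌉₊ with hTdef
  have hkR : (4 : ℝ) ≤ k := by exact_mod_cast hk
  have hT1 : (2 : ℝ) / ε ≤ T := Nat.le_ceil _
  have hT2 : (T : ℝ) < 2 / ε + 1 := Nat.ceil_lt_add_one (by positivity)
  have hT3 : 2 ≤ (T : ℝ) * ε := by rwa [div_le_iff₀ hε0] at hT1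
  have hT4 : (T : ℝ) * ε < 3 := by
    have : (T : ℝ) * ε < (2 / ε + 1) * ε := by gcongr
    have h2 : (2 / ε + 1) * ε = 2 + ε := by field_simp
    linarith
  have hn' : 48 * (k : ℝ) ≤ n * ε ^ 3 := by rwa [div_le_iff₀ (by positivity)] at hn
  have hn0 : (0 : ℝ) < n := by
    by_contra h
    have : (n : ℝ) * ε ^ 3 ≤ 0 := mul_nonpos_of_nonpos_of_nonneg (not_lt.1 h) (by positivity)
    linarith
  have hε2 : n * ε ^ 3 ≤ n * ε ^ 2 := by
    have : ε ^ 3 ≤ ε ^ 2 := by nlinarith [sq_nonneg ε]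
    gcongr
  refine rounds ε (ε ^ 2 / 6) hε0 (by positivity) T (by nlinarith) (by linarith) hn0 hk ?_ E hloops
    ?_ o t m hm hmk h0 hl hm0 hm1 T 0 (by omega) Set.univ Set.univ ?_ ?_ ?_
  · push_cast
    linarith
  · intro v
    exact hdeg v
  · intro hcol
    have h1 := (colorable_of_colr hcol).chromaticNumber_le
    have h2 : dchrom E ≤ roundBound (cstar (k - 1)) T := ENat.toNat_le_of_le_coe h1
    have h3 := roundBound_le (cstar (k - 1)) T
    obtain ⟨j, rfl⟩ : ∃ j, k = j + 2 := ⟨k - 2, by omega⟩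
    have hc := le_cstar j
    rw [show j + 2 - 1 = j + 1 by omega] at *
    set c := cstar (j + 1)
    have h4 : (dchrom E : ℝ) ≤ 2 * c * 2 ^ T := by
      have : dchrom E ≤ 2 * c * 2 ^ T := by omega
      exact_mod_cast this
    have hc0 : (0 : ℝ) < c := by exact_mod_cast (by omega : 0 < c)
    have h5 := hchrom.trans h4
    rw [div_le_iff₀ (by have : 0 < 1 - 2 * ε := by linarith
                        positivity)] at h5
    have h6 : (2 : ℝ) ^ T * ε ^ T ≤ 1 := by
      rw [← mul_pow]
      exact pow_le_one₀ (by positivity) (by linarith)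
    have h7 : (2 : ℝ) ^ T * ε ^ T * (1 - 2 * ε) ≤ 1 * 1 := by
      apply mul_le_mul h6 (by linarith) (by linarith) (by norm_num)
    have h8 : 2 * (c : ℝ) * 2 ^ T * (ε ^ T * (1 - 2 * ε))
        = 2 * c * ((2 : ℝ) ^ T * ε ^ T * (1 - 2 * ε)) := by ring
    rw [h8] at h5
    have h9 : 2 * (c : ℝ) * ((2 : ℝ) ^ T * ε ^ T * (1 - 2 * ε)) ≤ 2 * c * (1 * 1) := by gcongr
    linarith
  · intro v _
    simp
  · simp [Set.ncard_univ]
end
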